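/- arXiv:1801.06719 — 2 statements merged into one kernel-verified Lean document; each statement's English description precedes it below -/
import Mathlib

section
/- Suppose each pair of agents (i,j) is endowed with a function φ^{ij} : [0,∞) → [0,∞) such that φ^{ij}(σ) ∈ {0} ∪ [a,b] for all σ ≥ 0 (where 0 < a < b), φ^{ij}(σ) > 0 ⟺ φ^{ji}(σ) > 0 for all σ, and φ^{ii}(σ) ≡ φ^{ii} > 0 is a positive constant. Then for any initial opinions x_1(0),…,x_n(0) ∈ ℝ^m, the opinions obeying the heterogeneous dynamics x_i(k+1) = (Σ_{j=1}^n φ_{ij}(k) x_j(k)) / (Σ_{j=1}^n φ_{ij}(k)), with φ_{ij}(k) = φ^{ij}(|x_j(k) − x_i(k)|²), converge: lim_{k→∞} x_i(k) exists for every i. -/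
open Finset

/-- `x` evolves by averaging with the row-stochastic weights `A`, whose diagonal entries and nonzero
entries are at least `δ` and whose zero pattern is symmetric. -/
structure IsTypeSymmetricAveraging {ι : Type*} [Fintype ι] (A : ℕ → ι → ι → ℝ) (δ : ℝ)
    (x : ℕ → ι → ℝ) : Prop where
  pos : 0 < δ
  nonneg : ∀ k i j, 0 ≤ A k i j
  sum_eq_one : ∀ k i, ∑ j, A k i j = 1
  le_diag : ∀ k i, δ ≤ A k i i
  le_of_ne_zero : ∀ k i j, A k i j ≠ 0 → δ ≤ A k i j
  symm : ∀ k i j, A k i j ≠ 0 → A k j i ≠ 0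
  step : ∀ k i, x (k + 1) i = ∑ j, A k i j * x k j

/-- The set `C` receives no influence from outside at time `k`. -/
def IsClosedAt {ι : Type*} (A : ℕ → ι → ι → ℝ) (C : Finset ι) (k : ℕ) : Prop :=
  ∀ i ∈ C, ∀ j, A k i j ≠ 0 → j ∈ C

namespace IsTypeSymmetricAveraging

variable {ι : Type*} [Fintype ι] {A : ℕ → ι → ι → ℝ} {δ : ℝ} {x : ℕ → ι → ℝ}

lemma neg (h : IsTypeSymmetricAveraging A δ x) :
    IsTypeSymmetricAveraging A δ (fun k i => -x k i) :=
  { h with step := fun k i => by simp [h.step] }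

lemma le_step (h : IsTypeSymmetricAveraging A δ x) {C : Finset ι} {k : ℕ}
    (hC : IsClosedAt A C k) {i j : ι} (hi : i ∈ C) {μ c : ℝ} (hc : 0 ≤ c)
    (hμ : ∀ l ∈ C, μ ≤ x k l) (hij : δ ≤ A k i j) (hj : μ + c ≤ x k j) :
    μ + δ * c ≤ x (k + 1) i := by
  have hsum : x (k + 1) i - μ = ∑ l, A k i l * (x k l - μ) := by
    simp [h.step, mul_sub, Finset.sum_sub_distrib, ← Finset.sum_mul, h.sum_eq_one]
  have hterm : ∀ l ∈ univ, 0 ≤ A k i l * (x k l - μ) := by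
    intro l _
    by_cases hl : A k i l = 0
    · simp [hl]
    · exact mul_nonneg (h.nonneg k i l) (sub_nonneg.2 (hμ l (hC i hi l hl)))
  have hle := Finset.single_le_sum hterm (mem_univ j)
  have hmul : δ * c ≤ A k i j * (x k j - μ) :=
    mul_le_mul hij (by linarith) hc (h.nonneg k i j)
  linarith

lemma lower_bound_persists (h : IsTypeSymmetricAveraging A δ x) {C : Finset ι} {k k' : ℕ}
    (hkk : k ≤ k') (hC : ∀ l, k ≤ l → l < k' → IsClosedAt A C l) {μ : ℝ}
    (hμ : ∀ i ∈ C, μ ≤ x k i) : ∀ i ∈ C, μ ≤ x k' i := by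
  induction k', hkk using Nat.le_induction with
  | base => exact hμ
  | succ l hl ih =>
    intro i hi
    have hlow := ih fun r hr hrl => hC r hr (by omega)
    simpa using h.le_step (hC l hl (by omega)) hi le_rfl hlow (h.le_diag l i)
      (by simpa using hlow i hi)

/-- If no part of `C` ever becomes isolated from the rest of `C`, then a gain over the lower bound
`μ` present on a nonempty subset eventually spreads to all of `C`. -/
lemma exists_spread (h : IsTypeSymmetricAveraging A δ x) {C : Finset ι} {T : ℕ}
    (hC : ∀ k, T ≤ k → IsClosedAt A C k)
    (hconn : ∀ S ⊂ C, S.Nonempty → ∀ k, ∃ k', k ≤ k' ∧ ∃ i ∈ S, ∃ j ∈ C, j ∉ S ∧ A k' i j ≠ 0)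
    (r : ℕ) : ∀ (S : Finset ι) (k : ℕ) (μ c : ℝ), S ⊆ C → S.Nonempty → C.card ≤ S.card + r →
      T ≤ k → 0 ≤ c → (∀ i ∈ C, μ ≤ x k i) → (∀ i ∈ S, μ + c ≤ x k i) →
      ∃ k', k ≤ k' ∧ ∀ i ∈ C, μ + δ ^ r * c ≤ x k' i := by
  classical
  induction r with
  | zero =>
    intro S k μ c hSC _ hcard _ _ _ hgain
    obtain rfl := Finset.eq_of_subset_of_card_le hSC hcard
    exact ⟨k, le_rfl, by simpa using hgain⟩
  | succ r ih =>
    intro S k μ c hSC hne hcard hk hc hμ hgain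
    have hδ : δ ≤ 1 := by
      obtain ⟨i, -⟩ := hne
      exact (h.le_diag 0 i).trans ((Finset.single_le_sum (fun j _ => h.nonneg 0 i j)
        (mem_univ i)).trans_eq (h.sum_eq_one 0 i))
    rcases hSC.eq_or_ssubset with rfl | hss
    · refine ⟨k, le_rfl, fun i hi => le_trans ?_ (hgain i hi)⟩
      have := mul_le_of_le_one_left hc (pow_le_one₀ (n := r + 1) h.pos.le hδ)
      linarith
    · have hex := hconn S hss hne k
      obtain ⟨hkt, i, hi, j, hjC, hjS, hij⟩ := Nat.find_spec hex
      have hmin := fun l => Nat.find_min hex (m := l)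
      generalize Nat.find hex = t at *
      have hSclosed : ∀ l, k ≤ l → l < t → IsClosedAt A S l := by
        intro l hkl hlt p hp q hpq
        by_contra hq
        exact hmin l hlt ⟨hkl, p, hp, q, hC l (hk.trans hkl) p (hSC hp) q hpq, hq, hpq⟩
      have hgain' := h.lower_bound_persists hkt hSclosed hgain
      have hμ' := h.lower_bound_persists hkt (fun l hl _ => hC l (hk.trans hl)) hμ
      have hCt := hC t (hk.trans hkt)
      have hμ'' := h.lower_bound_persists (hkt.trans t.le_succ)
        (fun l hl _ => hC l (hk.trans hl)) hμ
      obtain ⟨k', hk', hfin⟩ := ih (insert j S) (t + 1) μ (δ * c)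
        (Finset.insert_subset hjC hSC) (Finset.insert_nonempty _ _)
        (by rw [Finset.card_insert_of_notMem hjS]; omega) (by omega)
        (mul_nonneg h.pos.le hc) hμ'' (by
          intro p hp
          rcases Finset.mem_insert.1 hp with rfl | hp
          · exact h.le_step hCt hjC hc hμ' (h.le_of_ne_zero _ _ _ (h.symm _ _ _ hij)) (hgain' i hi)
          · exact h.le_step hCt (hSC hp) hc hμ' (h.le_diag t p) (hgain' p hp))
      exact ⟨k', by omega, fun p hp => by simpa [pow_succ, mul_assoc] using hfin p hp⟩

lemma exists_consensus (h : IsTypeSymmetricAveraging A δ x) {C : Finset ι} (hne : C.Nonempty)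
    {T : ℕ} (hC : ∀ k, T ≤ k → IsClosedAt A C k)
    (hconn : ∀ S ⊂ C, S.Nonempty → ∀ k, ∃ k', k ≤ k' ∧ ∃ i ∈ S, ∃ j ∈ C, j ∉ S ∧ A k' i j ≠ 0) :
    ∃ L : ℝ, ∀ i ∈ C, Filter.Tendsto (fun k => x k i) Filter.atTop (nhds L) := by
  set lo : ℕ → ℝ := fun k => C.inf' hne (x (k + T))
  set hi : ℕ → ℝ := fun k => C.sup' hne (x (k + T)) with hhi
  have lo_le : ∀ k, ∀ i ∈ C, lo k ≤ x (k + T) i := fun k i hiC => Finset.inf'_le _ hiC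
  have le_hi : ∀ k, ∀ i ∈ C, x (k + T) i ≤ hi k := fun k i hiC => Finset.le_sup' _ hiC
  have lo_mono : Monotone lo := fun k k' hkk => Finset.le_inf' _ _ <|
    h.lower_bound_persists (by omega) (fun l hl _ => hC l (by omega)) (lo_le k)
  have hi_anti : Antitone hi := fun k k' hkk => Finset.sup'_le _ _ fun i hiC => by
    have := h.neg.lower_bound_persists (k := k + T) (k' := k' + T) (by omega)
      (fun l hl _ => hC l (by omega)) (μ := -hi k) (fun i hiC => neg_le_neg (le_hi k i hiC)) i hiC
    linarith
  have lo_le_hi : ∀ k, lo k ≤ hi k := fun k => by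
    obtain ⟨i, hiC⟩ := hne
    exact (lo_le k i hiC).trans (le_hi k i hiC)
  have lo_bdd : BddAbove (Set.range lo) := ⟨hi 0, by
    rintro _ ⟨k, rfl⟩
    exact (lo_le_hi k).trans (hi_anti k.zero_le)⟩
  have hi_bdd : BddBelow (Set.range hi) := ⟨lo 0, by
    rintro _ ⟨k, rfl⟩
    exact (lo_mono k.zero_le).trans (lo_le_hi k)⟩
  have lo_lim := tendsto_atTop_ciSup lo_mono lo_bdd
  have hi_lim := tendsto_atTop_ciInf hi_anti hi_bdd
  have hstep : ∀ k, lo k + δ ^ C.card * (hi k - lo k) ≤ ⨆ k, lo k := by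
    intro k
    obtain ⟨p, hp, hpmax⟩ := Finset.exists_mem_eq_sup' hne (x (k + T))
    obtain ⟨k', hk', hfin⟩ := h.exists_spread hC hconn C.card {p} (k + T) (lo k) (hi k - lo k)
      (by simpa using hp) (by simp) (by omega) (by omega) (sub_nonneg.2 (lo_le_hi k)) (lo_le k)
      (by simp [hhi, hpmax])
    refine le_trans (Finset.le_inf' hne _ ?_) (le_ciSup lo_bdd (k' - T))
    rwa [Nat.sub_add_cancel (by omega)]
  have hlim := le_of_tendsto'
    (lo_lim.add ((hi_lim.sub lo_lim).const_mul (δ ^ C.card))) hstep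
  have hle : (⨅ k, hi k) ≤ ⨆ k, lo k := by
    have hpos := pow_pos h.pos C.card
    by_contra! hlt
    have := mul_pos hpos (sub_pos.2 hlt)
    linarith
  have heq : (⨅ k, hi k) = ⨆ k, lo k :=
    le_antisymm hle (le_of_tendsto_of_tendsto' lo_lim hi_lim lo_le_hi)
  refine ⟨⨆ k, lo k, fun i hiC => (Filter.tendsto_add_atTop_iff_nat T).1 ?_⟩
  exact tendsto_of_tendsto_of_tendsto_of_le_of_le lo_lim (heq ▸ hi_lim)
    (fun k => lo_le k i hiC) (fun k => le_hi k i hiC)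

lemma exists_tendsto_of_closed (h : IsTypeSymmetricAveraging A δ x) (C : Finset ι) :
    ∀ T : ℕ, (∀ k, T ≤ k → IsClosedAt A C k) →
      ∀ i ∈ C, ∃ L : ℝ, Filter.Tendsto (fun k => x k i) Filter.atTop (nhds L) := by
  classical
  induction C using Finset.strongInduction with
  | H C ih =>
    intro T hC i hi
    by_cases hconn : ∀ S ⊂ C, S.Nonempty → ∀ k, ∃ k', k ≤ k' ∧
        ∃ i ∈ S, ∃ j ∈ C, j ∉ S ∧ A k' i j ≠ 0
    · obtain ⟨L, hL⟩ := h.exists_consensus ⟨i, hi⟩ hC hconn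
      exact ⟨L, hL i hi⟩
    · push Not at hconn
      obtain ⟨S, hSC, hne, t, ht⟩ := hconn
      by_cases hiS : i ∈ S
      · refine ih S hSC (max T t) (fun k hk p hp q hpq => ?_) i hiS
        by_contra hq
        exact hpq (ht k (le_of_max_le_right hk) p hp q
          (hC k (le_of_max_le_left hk) p (hSC.1 hp) q hpq) hq)
      · refine ih (C \ S) (Finset.sdiff_ssubset hSC.1 hne) (max T t)
          (fun k hk p hp q hpq => ?_) i (Finset.mem_sdiff.2 ⟨hi, hiS⟩)
        obtain ⟨hpC, hpS⟩ := Finset.mem_sdiff.1 hp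
        refine Finset.mem_sdiff.2 ⟨hC k (le_of_max_le_left hk) p hpC q hpq, fun hq => ?_⟩
        exact h.symm _ _ _ hpq (ht k (le_of_max_le_right hk) q hq p hpC hpS)

theorem exists_tendsto (h : IsTypeSymmetricAveraging A δ x) (i : ι) :
    ∃ L : ℝ, Filter.Tendsto (fun k => x k i) Filter.atTop (nhds L) :=
  h.exists_tendsto_of_closed univ 0 (fun _ _ _ _ _ _ => mem_univ _) i (mem_univ i)

end IsTypeSymmetricAveraging



/-- **Convergence of the heterogeneous distance-based averaging dynamics.**
Each ordered pair of agents `(i,j)` has its own distance-measuring function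
`φ i j : [0,∞) → [0,∞)` with `φ i j σ ∈ {0} ∪ [a,b]` (`0 < a < b`),
`φ i j σ > 0 ↔ φ j i σ > 0`, and `φ i i` a positive constant.  Then for any
initial opinions the heterogeneous dynamics
`xᵢ(k+1) = (∑ⱼ φᵢⱼ(k) xⱼ(k)) / (∑ⱼ φᵢⱼ(k))`, with
`φᵢⱼ(k) = φ i j (‖xⱼ(k) − xᵢ(k)‖²)`, converges: each `xᵢ(k)` has a limit. -/
theorem heterogeneous_distance_based_dynamics_converge (n m : ℕ) (a b : ℝ)
    (ha : 0 < a) (hab : a < b)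
    (φ : Fin n → Fin n → ℝ → ℝ)
    (hφ_range : ∀ i j σ, 0 ≤ σ → φ i j σ = 0 ∨ (a ≤ φ i j σ ∧ φ i j σ ≤ b))
    (hφ_symm : ∀ i j σ, 0 ≤ σ → (0 < φ i j σ ↔ 0 < φ j i σ))
    (hφ_diag_const : ∀ i σ, 0 ≤ σ → φ i i σ = φ i i 0)
    (hφ_diag_pos : ∀ i, 0 < φ i i 0)
    (x : ℕ → Fin n → EuclideanSpace ℝ (Fin m))
    (hdyn : ∀ k i, x (k + 1) i =
      (∑ j, φ i j (‖x k j - x k i‖ ^ 2))⁻¹ •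
        ∑ j, φ i j (‖x k j - x k i‖ ^ 2) • x k j) :
    ∀ i, ∃ L : EuclideanSpace ℝ (Fin m),
      Filter.Tendsto (fun k => x k i) Filter.atTop (nhds L) := by
  intro i
  have hb : 0 < b := ha.trans hab
  have hn : (0 : ℝ) < n := by exact_mod_cast i.pos
  set w : ℕ → Fin n → Fin n → ℝ := fun k i j => φ i j (‖x k j - x k i‖ ^ 2) with hw
  have w_range : ∀ k i j, w k i j = 0 ∨ (a ≤ w k i j ∧ w k i j ≤ b) :=
    fun k i j => hφ_range i j _ (sq_nonneg _)
  have w_nonneg : ∀ k i j, 0 ≤ w k i j := fun k i j => by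
    rcases w_range k i j with h | h
    · exact h.ge
    · exact ha.le.trans h.1
  have w_le : ∀ k i j, w k i j ≤ b := fun k i j => by
    rcases w_range k i j with h | h
    · exact h.le.trans hb.le
    · exact h.2
  have w_diag : ∀ k i, 0 < w k i i := fun k i => by simpa [hw] using hφ_diag_pos i
  have w_symm : ∀ k i j, 0 < w k i j → 0 < w k j i := fun k i j h => by
    have := (hφ_symm i j _ (sq_nonneg _)).1 h
    simpa only [hw, norm_sub_rev (x k i) (x k j)] using this
  have sum_pos : ∀ k i, 0 < ∑ j, w k i j := fun k i =>
    Finset.sum_pos' (fun j _ => w_nonneg k i j) ⟨i, mem_univ i, w_diag k i⟩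
  have sum_le : ∀ k i, ∑ j, w k i j ≤ n * b := fun k i => by
    simpa using Finset.sum_le_card_nsmul univ (w k i) b fun j _ => w_le k i j
  have le_weight : ∀ k i j, w k i j ≠ 0 → a / (n * b) ≤ w k i j / ∑ l, w k i l := fun k i j h =>
    div_le_div₀ (w_nonneg k i j) ((w_range k i j).resolve_left h).1 (sum_pos k i) (sum_le k i)
  have ne_of_div : ∀ k i j, w k i j / ∑ l, w k i l ≠ 0 → w k i j ≠ 0 :=
    fun k i j h => (div_ne_zero_iff.1 h).1
  have havg : ∀ c : Fin m, IsTypeSymmetricAveraging (fun k i j => w k i j / ∑ l, w k i l)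
      (a / (n * b)) (fun k i => x k i c) := fun c =>
    { pos := by positivity
      nonneg := fun k i j => div_nonneg (w_nonneg k i j) (sum_pos k i).le
      sum_eq_one := fun k i => by rw [← Finset.sum_div, div_self (sum_pos k i).ne']
      le_diag := fun k i => le_weight k i i (w_diag k i).ne'
      le_of_ne_zero := fun k i j h => le_weight k i j (ne_of_div k i j h)
      symm := fun k i j h => div_ne_zero
        (w_symm k i j ((w_nonneg k i j).lt_of_ne' (ne_of_div k i j h))).ne' (sum_pos k j).ne'
      step := fun k i => by
        rw [hdyn k i]
        simp [hw, Finset.mul_sum, div_eq_inv_mul, mul_assoc] }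
  choose L hL using fun c => (havg c).exists_tendsto i
  exact ⟨WithLp.toLp 2 L, ((PiLp.continuous_toLp 2 _).tendsto L).comp (tendsto_pi_nhds.2 hL)⟩
end

section
/- In the inertial HK model where every agent is either stubborn (λ_i = 0) or regular (λ_i = 1), the opinions asymptotically converge: for any initial opinions x_1(0),…,x_n(0) ∈ ℝ^m, the limit lim_{k→∞} x_i(k) exists for every agent i. -/
open Finset

open Filter Topology

section Graph

variable {ι E : Type*} [Fintype ι] [NormedAddCommGroup E] [InnerProductSpace ℝ E]

/-- Swapping the two endpoints in a sum over the edges of a symmetric graph. -/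
lemma sum_neighbors_swap {M : Type*} [AddCommMonoid M] {N : ι → Finset ι}
    (hN : ∀ i j, j ∈ N i → i ∈ N j) (f : ι → ι → M) :
    ∑ i, ∑ j ∈ N i, f i j = ∑ i, ∑ j ∈ N i, f j i := by
  refine Finset.sum_comm' fun i j => ?_
  simp only [mem_univ, true_and, and_true]
  exact ⟨hN i j, hN j i⟩

/-- Summation by parts for the graph Laplacian. -/
lemma sum_inner_sub_eq_neg_two_mul {N : ι → Finset ι}
    (hN : ∀ i j, j ∈ N i → i ∈ N j) (u v : ι → E) :
    ∑ i, ∑ j ∈ N i, inner ℝ (u j - u i) (v j - v i) =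
      -2 * ∑ i, inner ℝ (u i) (∑ j ∈ N i, (v j - v i)) := by
  have h1 : ∑ i, ∑ j ∈ N i, inner ℝ (u j) (v j - v i) =
      ∑ i, ∑ j ∈ N i, inner ℝ (u i) (v i - v j) :=
    sum_neighbors_swap hN _
  have h2 : ∑ i, ∑ j ∈ N i, inner ℝ (u i) (v i - v j) =
      -∑ i, ∑ j ∈ N i, inner ℝ (u i) (v j - v i) := by
    simp only [← Finset.sum_neg_distrib, ← inner_neg_right, neg_sub]
  have h3 : ∀ i, ∑ j ∈ N i, inner ℝ (u j - u i) (v j - v i) =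
      ∑ j ∈ N i, inner ℝ (u j) (v j - v i) - ∑ j ∈ N i, inner ℝ (u i) (v j - v i) := by
    simp only [inner_sub_left (𝕜 := ℝ), Finset.sum_sub_distrib, implies_true]
  rw [Finset.sum_congr rfl fun i _ => h3 i, Finset.sum_sub_distrib, h1, h2]
  simp only [inner_sum]
  ring

/-- A field on a union `A` of components which vanishes or is harmonic at every vertex of `A`
is constant along the edges of `A`. -/
lemma eq_of_mem_neighbors_of_harmonic {N : ι → Finset ι} (hN : ∀ i j, j ∈ N i → i ∈ N j)
    {A : Set ι} (hA : ∀ i ∈ A, ∀ j ∈ N i, j ∈ A) {z : ι → E}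
    (hz : ∀ i ∈ A, z i = 0 ∨ ∑ j ∈ N i, (z j - z i) = 0) {i j : ι} (hi : i ∈ A)
    (hj : j ∈ N i) : z j = z i := by
  classical
  have key := sum_inner_sub_eq_neg_two_mul hN (A.indicator z) z
  have hR : ∑ i, inner ℝ (A.indicator z i) (∑ j ∈ N i, (z j - z i)) = 0 := by
    refine Finset.sum_eq_zero fun a _ => ?_
    by_cases ha : a ∈ A
    · rcases hz a ha with h | h <;> simp [ha, h]
    · simp [ha]
  have hterm : ∀ a, ∀ b ∈ N a,
      0 ≤ inner ℝ (A.indicator z b - A.indicator z a) (z b - z a) := by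
    intro a b hb
    by_cases ha : a ∈ A
    · rw [Set.indicator_of_mem ha, Set.indicator_of_mem (hA a ha b hb)]
      exact real_inner_self_nonneg
    · have hb' : b ∉ A := fun h => ha (hA b h a (hN a b hb))
      simp [ha, hb']
  rw [hR, mul_zero, Finset.sum_eq_zero_iff_of_nonneg
    (fun a _ => Finset.sum_nonneg (hterm a))] at key
  have h := (Finset.sum_eq_zero_iff_of_nonneg (hterm i)).1 (key i (mem_univ i)) j hj
  rw [Set.indicator_of_mem hi, Set.indicator_of_mem (hA i hi j hj), inner_self_eq_zero] at h
  exact sub_eq_zero.1 h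

/-- `j` can be reached from `i` along edges of `N`. -/
def Reaches (N : ι → Finset ι) : ι → ι → Prop :=
  Relation.ReflTransGen fun a b => b ∈ N a

/-- The component of `i` contains a vertex of `S`. -/
def Attached (N : ι → Finset ι) (S : Set ι) (i : ι) : Prop :=
  ∃ s ∈ S, Reaches N i s

/-- `y` is harmonic outside `S`. -/
def HarmonicOff (N : ι → Finset ι) (S : Set ι) (y : ι → E) : Prop :=
  ∀ i ∉ S, ∑ j ∈ N i, (y j - y i) = 0

lemma HarmonicOff.eq_of_attached {N : ι → Finset ι} (hN : ∀ i j, j ∈ N i → i ∈ N j)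
    {S : Set ι} {y y' : ι → E} (hy : HarmonicOff N S y) (hy' : HarmonicOff N S y')
    (hS : ∀ s ∈ S, y s = y' s) {i : ι} (hi : Attached N S i) : y i = y' i := by
  obtain ⟨s, hs, hr⟩ := hi
  have hedge : ∀ a, ∀ b ∈ N a, (y - y') b = (y - y') a := by
    intro a b hb
    refine eq_of_mem_neighbors_of_harmonic hN (A := Set.univ) (by simp) ?_ (Set.mem_univ a) hb
    intro c _
    by_cases hc : c ∈ S
    · exact Or.inl (by simp [hS c hc])
    · right
      have h : ∀ e ∈ N c, (y - y') e - (y - y') c = (y e - y c) - (y' e - y' c) := by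
        intro e _
        simp only [Pi.sub_apply]
        abel
      rw [Finset.sum_congr rfl h, Finset.sum_sub_distrib, hy c hc, hy' c hc, sub_zero]
  have hconst : ∀ c, Reaches N i c → (y - y') c = (y - y') i := by
    intro c hc
    induction hc with
    | refl => rfl
    | tail _ hbc ih => exact (hedge _ _ hbc).trans ih
  have h0 : (y - y') s = 0 := by simp [hS s hs]
  exact sub_eq_zero.1 ((hconst s hr).symm.trans h0)

lemma HarmonicOff.eq_of_reaches {N : ι → Finset ι} (hN : ∀ i j, j ∈ N i → i ∈ N j)
    {S : Set ι} {y : ι → E} (hy : HarmonicOff N S y) {i j : ι} (hi : ¬Attached N S i)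
    (hij : Reaches N i j) : y j = y i := by
  induction hij with
  | refl => rfl
  | tail hab hbc ih =>
    refine Eq.trans ?_ ih
    refine eq_of_mem_neighbors_of_harmonic hN (A := {a | Reaches N i a})
      (fun a ha b hb => ha.tail hb) (fun a ha => Or.inr (hy a fun h => hi ⟨a, h, ha⟩)) hab hbc

/-- The possible values at `i` of the solutions of the Dirichlet problem with boundary data `b`
on `S`, over all symmetric graphs in which `i` is attached to `S`. -/
def dirichletValues (S : Set ι) (b : ι → E) (i : ι) : Set E :=
  {p | ∃ N : ι → Finset ι, (∀ i j, j ∈ N i → i ∈ N j) ∧ Attached N S i ∧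
    ∃ y, HarmonicOff N S y ∧ (∀ s ∈ S, y s = b s) ∧ y i = p}

lemma finite_dirichletValues (S : Set ι) (b : ι → E) (i : ι) :
    (dirichletValues S b i).Finite := by
  classical
  simp only [dirichletValues, Set.ofPred_exists]
  refine Set.finite_iUnion fun N => Set.Subsingleton.finite ?_
  rintro p ⟨hN, hi, y, hy, hyb, rfl⟩ q ⟨-, -, y', hy', hyb', rfl⟩
  exact hy.eq_of_attached hN hy' (fun s hs => (hyb s hs).trans (hyb' s hs).symm) hi

end Graph

/-- A sequence whose steps tend to zero and which approaches a finite set converges. -/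
lemma exists_tendsto_of_finite {E : Type*} [MetricSpace E] {u : ℕ → E} {P : Set E}
    (hP : P.Finite) (hstep : Tendsto (fun k => dist (u (k + 1)) (u k)) atTop (𝓝 0))
    (hu : ∀ ε > 0, ∀ᶠ k in atTop, ∃ p ∈ P, dist (u k) p < ε) :
    ∃ p, Tendsto u atTop (𝓝 p) := by
  obtain ⟨r, hr, hsep⟩ : ∃ r > 0, ∀ p ∈ P, ∀ q ∈ P, dist p q < r → p = q := by
    have h : ∀ z ∈ P ×ˢ P, ∀ᶠ r in 𝓝[>] (0 : ℝ), dist z.1 z.2 < r → z.1 = z.2 := by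
      intro z _
      by_cases hz : z.1 = z.2
      · simp [hz]
      · filter_upwards [Ioo_mem_nhdsGT (dist_pos.2 hz)] with r hr h
        exact absurd h hr.2.not_gt
    obtain ⟨r, hr, hr0⟩ := (((hP.prod hP).eventually_all.2 h).and self_mem_nhdsWithin).exists
    exact ⟨r, hr0, fun p hp q hq => hr (p, q) ⟨hp, hq⟩⟩
  have hstep' : ∀ᶠ k in atTop, dist (u (k + 1)) (u k) < r / 3 :=
    hstep.eventually_lt_const (by positivity)
  obtain ⟨K, hK⟩ := eventually_atTop.1 (hstep'.and (hu (r / 3) (by positivity)))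
  obtain ⟨p, hp, hpK⟩ := (hK K le_rfl).2
  have hnear : ∀ k ≥ K, dist (u k) p < r / 3 := by
    intro k hk
    induction k, hk using Nat.le_induction with
    | base => exact hpK
    | succ k hk ih =>
      obtain ⟨q, hq, hqk⟩ := (hK (k + 1) (by omega)).2
      have hs := (hK k hk).1
      have h : q = p := hsep q hq p hp (by
        have h1 := dist_triangle4 q (u (k + 1)) (u k) p
        rw [dist_comm q (u (k + 1))] at h1
        linarith)
      exact h ▸ hqk
  refine ⟨p, Metric.tendsto_atTop'.2 fun ε hε => ?_⟩
  obtain ⟨K', hK'⟩ := eventually_atTop.1 (hu (min ε (r / 3)) (by positivity))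
  refine ⟨max K K', fun k hk => ?_⟩
  obtain ⟨q, hq, hqk⟩ := hK' k (by omega)
  have h1 := hnear k (by omega)
  have h : q = p := hsep q hq p hp (by
    have h2 := dist_triangle_left q p (u k)
    have h3 := min_le_right ε (r / 3)
    linarith)
  exact h ▸ hqk.trans_le (min_le_left _ _)

section HK

variable {ι E : Type*} [Fintype ι] [NormedAddCommGroup E]

/-- The trust sets of the opinion profile `y`. -/
noncomputable def trustSet (d : ℝ) (y : ι → E) (i : ι) : Finset ι :=
  univ.filter fun j => ‖y j - y i‖ ≤ d

lemma mem_trustSet {d : ℝ} {y : ι → E} {i j : ι} : j ∈ trustSet d y i ↔ ‖y j - y i‖ ≤ d := by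
  simp [trustSet]

lemma trustSet_symm {d : ℝ} {y : ι → E} (i j : ι) (h : j ∈ trustSet d y i) :
    i ∈ trustSet d y j := by
  rw [mem_trustSet] at h ⊢
  rwa [norm_sub_rev]

lemma self_mem_trustSet {d : ℝ} (hd : 0 ≤ d) (y : ι → E) (i : ι) : i ∈ trustSet d y i := by
  simpa [mem_trustSet] using hd

lemma card_trustSet_ne_zero {d : ℝ} (hd : 0 ≤ d) (y : ι → E) (i : ι) :
    (#(trustSet d y i) : ℝ) ≠ 0 :=
  Nat.cast_ne_zero.2 (Finset.card_ne_zero_of_mem (self_mem_trustSet hd y i))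

/-- The truncated quadratic energy of an opinion profile. -/
noncomputable def hkEnergy (d : ℝ) (y : ι → E) : ℝ :=
  ∑ i, ∑ j, min (‖y j - y i‖ ^ 2) (d ^ 2)

lemma hkEnergy_nonneg (d : ℝ) (y : ι → E) : 0 ≤ hkEnergy d y :=
  Finset.sum_nonneg fun _ _ => Finset.sum_nonneg fun _ _ => by positivity

variable [InnerProductSpace ℝ E]

/-- HK dynamics in which the agents of `S` are stubborn and the others are regular. -/
structure IsHKTrajectory (d : ℝ) (S : Set ι) (x : ℕ → ι → E) : Prop where
  stubborn : ∀ k, ∀ i ∈ S, x (k + 1) i = x k i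
  regular : ∀ k, ∀ i ∉ S,
    x (k + 1) i = (#(trustSet d (x k) i) : ℝ)⁻¹ • ∑ j ∈ trustSet d (x k) i, x k j

namespace IsHKTrajectory

variable {d : ℝ} {S : Set ι} {x : ℕ → ι → E}

lemma eq_initial (h : IsHKTrajectory d S x) (k : ℕ) {i : ι} (hi : i ∈ S) : x k i = x 0 i := by
  induction k with
  | zero => rfl
  | succ k ih => rw [h.stubborn k i hi, ih]

lemma card_smul_step (h : IsHKTrajectory d S x) (hd : 0 ≤ d) (k : ℕ) {i : ι} (hi : i ∉ S) :
    (#(trustSet d (x k) i) : ℝ) • (x (k + 1) i - x k i) =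
      ∑ j ∈ trustSet d (x k) i, (x k j - x k i) := by
  rw [smul_sub, h.regular k i hi, smul_inv_smul₀ (card_trustSet_ne_zero hd _ _),
    Finset.sum_sub_distrib, Finset.sum_const, Nat.cast_smul_eq_nsmul]

lemma norm_le (h : IsHKTrajectory d S x) (hd : 0 ≤ d) (k : ℕ) (i : ι) :
    ‖x k i‖ ≤ ∑ j, ‖x 0 j‖ := by
  induction k generalizing i with
  | zero =>
    exact Finset.single_le_sum (f := fun j => ‖x 0 j‖) (fun _ _ => norm_nonneg _) (mem_univ i)
  | succ k ih =>
    by_cases hi : i ∈ S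
    · rw [h.stubborn k i hi]
      exact ih i
    · rw [h.regular k i hi, norm_smul, norm_inv, Real.norm_natCast,
        inv_mul_le_iff₀ (by have := card_trustSet_ne_zero hd (x k) i; positivity)]
      calc _ ≤ ∑ j ∈ trustSet d (x k) i, ‖x k j‖ := norm_sum_le _ _
        _ ≤ _ := by
          rw [← nsmul_eq_mul]
          exact Finset.sum_le_card_nsmul _ _ _ fun j _ => ih j

/-- The energy drops by at least four times the sum of the squared steps. -/
lemma hkEnergy_succ_add_le (h : IsHKTrajectory d S x) (hd : 0 ≤ d) (k : ℕ) :
    hkEnergy d (x (k + 1)) + 4 * ∑ i, ‖x (k + 1) i - x k i‖ ^ 2 ≤ hkEnergy d (x k) := by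
  set N := trustSet d (x k) with hNdef
  have hN : ∀ i j, j ∈ N i → i ∈ N j := trustSet_symm
  set δ : ι → E := fun i => x (k + 1) i - x k i with hδ
  have hdrop : ∑ i, ∑ j ∈ N i, (‖x k j - x k i‖ ^ 2 - ‖x (k + 1) j - x (k + 1) i‖ ^ 2) ≤
      hkEnergy d (x k) - hkEnergy d (x (k + 1)) := by
    simp only [hkEnergy, ← Finset.sum_sub_distrib]
    refine Finset.sum_le_sum fun i _ => ?_
    rw [hNdef, trustSet, Finset.sum_filter]
    refine Finset.sum_le_sum fun j _ => ?_
    split_ifs with hij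
    · rw [min_eq_left (pow_le_pow_left₀ (norm_nonneg _) hij 2)]
      exact sub_le_sub_left (min_le_left _ _) _
    · rw [min_eq_right (pow_le_pow_left₀ hd (not_le.1 hij).le 2)]
      exact sub_nonneg.2 (min_le_right _ _)
  have hexp : ∀ i j, ‖x k j - x k i‖ ^ 2 - ‖x (k + 1) j - x (k + 1) i‖ ^ 2 =
      -2 * inner ℝ (δ j - δ i) (x k j - x k i) - 2 * ‖δ i‖ ^ 2 - 2 * ‖δ j‖ ^ 2
        + ‖δ i + δ j‖ ^ 2 := by
    intro i j
    have h1 : x (k + 1) j - x (k + 1) i = (δ j - δ i) + (x k j - x k i) := by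
      simp only [hδ]
      abel
    rw [h1, norm_add_sq_real, norm_sub_sq_real (δ j), norm_add_sq_real (δ i),
      real_inner_comm (δ i) (δ j)]
    ring
  have hlap : ∑ i, inner ℝ (δ i) (∑ j ∈ N i, (x k j - x k i)) = ∑ i, #(N i) * ‖δ i‖ ^ 2 := by
    refine Finset.sum_congr rfl fun i _ => ?_
    by_cases hi : i ∈ S
    · have h0 : δ i = 0 := sub_eq_zero.2 (h.stubborn k i hi)
      simp [h0]
    · rw [← h.card_smul_step hd k hi, real_inner_smul_right, real_inner_self_eq_norm_sq]
  have hsq : ∑ i, ∑ _j ∈ N i, ‖δ i‖ ^ 2 = ∑ i, #(N i) * ‖δ i‖ ^ 2 := by simp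
  have hsq' : ∑ i, ∑ j ∈ N i, ‖δ j‖ ^ 2 = ∑ i, #(N i) * ‖δ i‖ ^ 2 := by
    rw [← hsq]
    exact sum_neighbors_swap hN _
  have hdiag : 4 * ∑ i, ‖δ i‖ ^ 2 ≤ ∑ i, ∑ j ∈ N i, ‖δ i + δ j‖ ^ 2 := by
    rw [Finset.mul_sum]
    refine Finset.sum_le_sum fun i _ => ?_
    refine le_trans (le_of_eq ?_) (Finset.single_le_sum (f := fun j => ‖δ i + δ j‖ ^ 2)
      (fun _ _ => by positivity) (self_mem_trustSet hd (x k) i))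
    simp only [← two_smul ℝ, norm_smul, mul_pow]
    norm_num
  simp only [hexp, Finset.sum_add_distrib, Finset.sum_sub_distrib (fun _ => (_ : ℝ)),
    ← Finset.mul_sum, sum_inner_sub_eq_neg_two_mul hN, hlap, hsq, hsq'] at hdrop
  linarith

lemma tendsto_step (h : IsHKTrajectory d S x) (hd : 0 ≤ d) (i : ι) :
    Tendsto (fun k => x (k + 1) i - x k i) atTop (𝓝 0) := by
  have hanti : Antitone fun k => hkEnergy d (x k) := antitone_nat_of_succ_le fun k => by
    have h1 := h.hkEnergy_succ_add_le hd k
    have h2 : 0 ≤ ∑ i, ‖x (k + 1) i - x k i‖ ^ 2 := by positivity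
    linarith
  have hlim := tendsto_atTop_ciInf hanti ⟨0, by rintro _ ⟨k, rfl⟩; exact hkEnergy_nonneg _ _⟩
  have hdiff := hlim.sub (hlim.comp (tendsto_add_atTop_nat 1))
  rw [sub_self] at hdiff
  have hsq : Tendsto (fun k => ‖x (k + 1) i - x k i‖ ^ 2) atTop (𝓝 0) := by
    refine squeeze_zero (fun _ => by positivity) (fun k => ?_) hdiff
    have h1 := h.hkEnergy_succ_add_le hd k
    have h2 : ‖x (k + 1) i - x k i‖ ^ 2 ≤ ∑ i, ‖x (k + 1) i - x k i‖ ^ 2 :=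
      Finset.single_le_sum (f := fun i => ‖x (k + 1) i - x k i‖ ^ 2)
        (fun _ _ => by positivity) (mem_univ i)
    have h3 : 0 ≤ ‖x (k + 1) i - x k i‖ ^ 2 := by positivity
    simp only [Function.comp_apply]
    linarith
  rw [tendsto_zero_iff_norm_tendsto_zero]
  simpa [Real.sqrt_sq] using hsq.sqrt

/-- A property that holds infinitely often holds along a subsequence with constant trust sets
that converges to a solution of the Dirichlet problem. -/
lemma exists_subseq_tendsto [FiniteDimensional ℝ E] (h : IsHKTrajectory d S x) (hd : 0 ≤ d)
    {Q : ℕ → Prop} (hQ : ∃ᶠ k in atTop, Q k) :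
    ∃ (N : ι → Finset ι) (y : ι → E) (φ : ℕ → ℕ), (∀ i j, j ∈ N i → i ∈ N j) ∧
      (∀ n, Q (φ n)) ∧ (∀ n, trustSet d (x (φ n)) = N) ∧
      (∀ i, Tendsto (fun n => x (φ n) i) atTop (𝓝 (y i))) ∧
      HarmonicOff N S y ∧ ∀ s ∈ S, y s = x 0 s := by
  classical
  obtain ⟨N, hN⟩ : ∃ N, ∃ᶠ k in atTop, Q k ∧ trustSet d (x k) = N := by
    by_contra hcon
    rw [not_exists] at hcon
    refine hQ ((eventually_all.2 fun N => not_frequently.1 (hcon N)).mono fun k hk hQk => ?_)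
    exact hk _ ⟨hQk, rfl⟩
  obtain ⟨φ, hφ, hφN⟩ := extraction_of_frequently_atTop hN
  have : ProperSpace E := FiniteDimensional.proper ℝ E
  have hbdd : ∀ n, x (φ n) ∈ Metric.closedBall (0 : ι → E) (∑ j, ‖x 0 j‖) := fun n =>
    mem_closedBall_zero_iff.2
      ((pi_norm_le_iff_of_nonneg (by positivity)).2 fun i => h.norm_le hd (φ n) i)
  obtain ⟨y, -, ψ, hψ, hy⟩ := tendsto_subseq_of_bounded Metric.isBounded_closedBall hbdd
  rw [tendsto_pi_nhds] at hy
  refine ⟨N, y, φ ∘ ψ, ?_, fun n => (hφN _).1, fun n => (hφN _).2, hy, fun i hi => ?_,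
    fun s hs => ?_⟩
  · rw [← (hφN 0).2]
    exact trustSet_symm
  · have h1 : Tendsto (fun n => ∑ j ∈ N i, (x (φ (ψ n)) j - x (φ (ψ n)) i)) atTop
        (𝓝 (∑ j ∈ N i, (y j - y i))) :=
      tendsto_finsetSum _ fun j _ => (hy j).sub (hy i)
    have h2 := (((h.tendsto_step hd i).comp (hφ.comp hψ).tendsto_atTop).const_smul
      (#(N i) : ℝ))
    rw [smul_zero] at h2
    refine tendsto_nhds_unique h1 (h2.congr fun n => ?_)
    have h3 := h.card_smul_step hd (φ (ψ n)) hi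
    rwa [(hφN (ψ n)).2] at h3
  · refine tendsto_nhds_unique (hy s) (tendsto_const_nhds.congr fun n => ?_)
    exact (h.eq_initial _ hs).symm

lemma eventually_dist_lt_of_attached [FiniteDimensional ℝ E] (h : IsHKTrajectory d S x)
    (hd : 0 ≤ d) (i : ι) {ε : ℝ} (hε : 0 < ε) :
    ∀ᶠ k in atTop, Attached (trustSet d (x k)) S i →
      ∃ p ∈ dirichletValues S (x 0) i, dist (x k i) p < ε := by
  by_contra hcon
  obtain ⟨N, y, φ, hN, hQ, hφ, hy, hharm, hS⟩ :=
    h.exists_subseq_tendsto hd (not_eventually.1 hcon)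
  push Not at hQ
  obtain ⟨n, hn⟩ := (Metric.tendsto_nhds.1 (hy i) ε hε).exists
  exact ((hQ n).2 (y i) ⟨N, hN, hφ n ▸ (hQ n).1, y, hharm, hS, rfl⟩).not_gt hn

lemma eventually_dist_lt_of_not_attached [FiniteDimensional ℝ E] (h : IsHKTrajectory d S x)
    (hd : 0 ≤ d) (i j : ι) {ε : ℝ} (hε : 0 < ε) :
    ∀ᶠ k in atTop, ¬Attached (trustSet d (x k)) S i → Reaches (trustSet d (x k)) i j →
      dist (x k j) (x k i) < ε := by
  by_contra hcon
  obtain ⟨N, y, φ, hN, hQ, hφ, hy, hharm, hS⟩ :=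
    h.exists_subseq_tendsto hd (not_eventually.1 hcon)
  push Not at hQ
  have hyij : y j = y i := hharm.eq_of_reaches hN (hφ 0 ▸ (hQ 0).1) (hφ 0 ▸ (hQ 0).2.1)
  have hlim := (hy j).dist (hy i)
  rw [hyij, dist_self] at hlim
  obtain ⟨n, hn⟩ := (hlim.eventually_lt_const hε).exists
  exact (hQ n).2.2.not_gt hn

/-- Eventually, an agent that is detached from the stubborn agents at two consecutive times
does not move at the second one. -/
lemma eventually_step_eq [FiniteDimensional ℝ E] (h : IsHKTrajectory d S x) (hd : 0 < d)
    (i : ι) :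
    ∀ᶠ k in atTop, ¬Attached (trustSet d (x k)) S i →
      ¬Attached (trustSet d (x (k + 1))) S i → x (k + 2) i = x (k + 1) i := by
  have hε : 0 < d / 3 := by positivity
  have hclose := eventually_all.2 fun j => h.eventually_dist_lt_of_not_attached hd.le i j hε
  have hstep : ∀ᶠ k in atTop, ∀ j, dist (x (k + 1) j) (x k j) < d / 3 :=
    eventually_all.2 fun j => by
      simpa only [dist_eq_norm] using
        ((h.tendsto_step hd.le j).norm.eventually_lt_const (by simpa using hε))
  filter_upwards [hclose, (tendsto_add_atTop_nat 1).eventually hclose, hstep]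
    with k hk hk1 hs hi hi1
  have hiS : i ∉ S := fun hi' => hi ⟨i, hi', .refl⟩
  have hN : ∀ j, Reaches (trustSet d (x k)) i j → trustSet d (x k) j = trustSet d (x k) i := by
    have hmem : ∀ j, Reaches (trustSet d (x k)) i j → ∀ l, l ∈ trustSet d (x k) j ↔
        Reaches (trustSet d (x k)) i l := by
      refine fun j hj l => ⟨fun hl => hj.tail hl, fun hl => ?_⟩
      have h1 := hk j hi hj
      have h2 := hk l hi hl
      rw [mem_trustSet, ← dist_eq_norm]
      linarith [dist_triangle_right (x k l) (x k j) (x k i)]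
    intro j hj
    ext l
    rw [hmem j hj, hmem i .refl]
  have heq : ∀ j ∈ trustSet d (x (k + 1)) i, x (k + 1) j = x (k + 1) i := by
    intro j hj
    have h1 := hk1 j hi1 (.single hj)
    have hj' : j ∈ trustSet d (x k) i := by
      rw [mem_trustSet, ← dist_eq_norm]
      have h2 := dist_triangle4 (x k j) (x (k + 1) j) (x (k + 1) i) (x k i)
      rw [dist_comm (x k j) (x (k + 1) j)] at h2
      linarith [hs i, hs j]
    have hr : Reaches (trustSet d (x k)) i j := .single hj'
    rw [h.regular k j fun hjS => hi ⟨j, hjS, hr⟩, h.regular k i hiS, hN j hr]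
  rw [h.regular (k + 1) i hiS, Finset.sum_congr rfl heq, Finset.sum_const,
    ← Nat.cast_smul_eq_nsmul ℝ, inv_smul_smul₀ (card_trustSet_ne_zero hd.le _ _)]

theorem exists_tendsto [FiniteDimensional ℝ E] (h : IsHKTrajectory d S x) (hd : 0 < d) (i : ι) :
    ∃ L, Tendsto (fun k => x k i) atTop (𝓝 L) := by
  have hfrozen := h.eventually_step_eq hd i
  by_cases hatt : ∃ᶠ k in atTop, Attached (trustSet d (x k)) S i
  · have hdist : Tendsto (fun k => dist (x (k + 1) i) (x k i)) atTop (𝓝 0) := by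
      simpa only [dist_eq_norm, norm_zero] using (h.tendsto_step hd.le i).norm
    refine exists_tendsto_of_finite (finite_dirichletValues S (x 0) i) hdist fun ε hε => ?_
    have hε' : 0 < ε / 3 := by positivity
    obtain ⟨K, hK⟩ := eventually_atTop.1 (hfrozen.and
      ((h.eventually_dist_lt_of_attached hd.le i hε').and (hdist.eventually_lt_const hε')))
    obtain ⟨K', hKK', hK'⟩ := frequently_atTop.1 hatt K
    refine eventually_atTop.2 ⟨K', fun k hk => And.left
      (b := ∃ p ∈ dirichletValues S (x 0) i, dist (x (k + 1) i) p < ε) ?_⟩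
    induction k, hk using Nat.le_induction with
    | base =>
      obtain ⟨p, hp, hpK⟩ := (hK K' hKK').2.1 hK'
      have h1 := (hK K' hKK').2.2
      exact ⟨⟨p, hp, by linarith⟩, p, hp, by linarith [dist_triangle (x (K' + 1) i) (x K' i) p]⟩
    | succ k hk ih =>
      refine ⟨ih.2, ?_⟩
      have h1 := hK k (by omega)
      have h2 := hK (k + 1) (by omega)
      have h3 := h1.2.2
      have h4 := h2.2.2
      by_cases ha1 : Attached (trustSet d (x (k + 1))) S i
      · obtain ⟨p, hp, hpk⟩ := h2.2.1 ha1
        exact ⟨p, hp, by linarith [dist_triangle (x (k + 1 + 1) i) (x (k + 1) i) p]⟩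
      by_cases ha : Attached (trustSet d (x k)) S i
      · obtain ⟨p, hp, hpk⟩ := h1.2.1 ha
        exact ⟨p, hp, by
          linarith [dist_triangle4 (x (k + 1 + 1) i) (x (k + 1) i) (x k i) p]⟩
      · rw [h1.1 ha ha1]
        exact ih.2
  · obtain ⟨K, hK⟩ := eventually_atTop.1 (hfrozen.and (not_frequently.1 hatt))
    refine ⟨x (K + 1) i, tendsto_const_nhds.congr' (eventually_atTop.2 ⟨K + 1, fun k hk => ?_⟩)⟩
    induction k, hk using Nat.le_induction with
    | base => rfl
    | succ k hk ih =>
      obtain ⟨l, rfl⟩ : ∃ l, k = l + 1 := ⟨k - 1, by omega⟩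
      rw [ih]
      exact ((hK l (by omega)).1 (hK l (by omega)).2 (hK (l + 1) (by omega)).2).symm

end IsHKTrajectory

end HK

/-- **Convergence of the HK model with stubborn agents (Chazelle–Wang).**
In the inertial HK model
`xᵢ(k+1) = (1 − λᵢ) xᵢ(k) + (λᵢ/|Iᵢ(x(k))|) ∑_{j ∈ Iᵢ(x(k))} xⱼ(k)`,
where every agent is either stubborn (`λᵢ = 0`) or regular (`λᵢ = 1`),
all opinions asymptotically converge. -/
theorem hk_stubborn_converges (n m : ℕ) (d : ℝ) (hd : 0 < d)
    (lam : Fin n → ℝ) (hlam : ∀ i, lam i = 0 ∨ lam i = 1)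
    (x : ℕ → Fin n → EuclideanSpace ℝ (Fin m))
    (hdyn : ∀ k i, x (k + 1) i =
      (1 - lam i) • x k i +
      (lam i * (((univ.filter (fun j => ‖x k j - x k i‖ ≤ d)).card : ℝ))⁻¹) •
        (∑ j ∈ univ.filter (fun j => ‖x k j - x k i‖ ≤ d), x k j)) :
    ∀ i, ∃ L : EuclideanSpace ℝ (Fin m),
      Filter.Tendsto (fun k => x k i) Filter.atTop (nhds L) := by
  have h : IsHKTrajectory d {i | lam i = 0} x := by
    refine ⟨fun k i hi => ?_, fun k i hi => ?_⟩
    · have hi' : lam i = 0 := hi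
      simp [hdyn k i, hi']
    · have hi' : lam i = 1 := (hlam i).resolve_left hi
      simp [hdyn k i, hi', trustSet]
  exact h.exists_tendsto hd
end
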